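/- There exists a constant K_o > 2, depending only on σ, such that the following holds. Let n = 2 and let Φ : [0,∞) → [0,∞) be monotone nondecreasing and lower semicontinuous with Φ(t) = t^γ for all t ∈ [0,1], where γ ∈ (0, 4/(2−σ)), and Φ(t) = 1 for all t ∈ [2, K_o]. Then there exist radii R_o > r_o > 0 such that the pair (ũ, Ẽ) is a minimal pair in the ball B_{R_o}, and for every r ∈ (0, r_o] the pair (ũ, Ẽ) is not a minimal pair in B_r. -/

import Mathlib

open MeasureTheory Filter Set Metric Bornology
open scoped ENNReal Topology symmDiff

noncomputable section

abbrev Pt (n : ℕ) : Type := EuclideanSpace ℝ (Fin n)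

/-- The interaction functional `L(A,B) = ∫_A ∫_B |x-y|^{-(n+σ)} dy dx`. -/
def interL (n : ℕ) (σ : ℝ) (A B : Set (Pt n)) : ℝ≥0∞ :=
  ∫⁻ x in A, ∫⁻ y in B, ENNReal.ofReal (‖x - y‖ ^ (-((n : ℝ) + σ)))

/-- The fractional `σ`-perimeter of `E` in `D`. -/
def fracPer (n : ℕ) (σ : ℝ) (E D : Set (Pt n)) : ℝ≥0∞ :=
  interL n σ (E ∩ D) Eᶜ + interL n σ (Eᶜ ∩ D) (E ∩ Dᶜ)

/-- `u` (locally integrable) has weak gradient `G` on the open set `U`. -/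
def HasWeakGradOn (n : ℕ) (u : Pt n → ℝ) (G : Pt n → Pt n) (U : Set (Pt n)) : Prop :=
  LocallyIntegrableOn G U volume ∧
  ∀ (i : Fin n) (φ : Pt n → ℝ), ContDiff ℝ (⊤ : ℕ∞) φ → HasCompactSupport φ →
    tsupport φ ⊆ U →
    ∫ x, u x * fderiv ℝ φ x (EuclideanSpace.single i 1) = -∫ x, G x i * φ x

/-- The zero-extension (by `0` outside `Ω`) of `w` has a square-integrable weak
gradient on all of `ℝⁿ`. -/
def ZeroExtGradL2 (n : ℕ) (Ω : Set (Pt n)) (w : Pt n → ℝ) : Prop :=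
  ∃ H : Pt n → Pt n,
    HasWeakGradOn n (Ω.indicator w) H Set.univ ∧
    Integrable (fun x => ‖H x‖ ^ 2) volume

/-- An admissible pair `(u,E)` in `Ω`, with `G` a weak gradient of `u` on `Ω`. -/
structure AdmissiblePair (n : ℕ) (σ : ℝ) (Ω : Set (Pt n)) (u : Pt n → ℝ)
    (G : Pt n → Pt n) (E : Set (Pt n)) : Prop where
  locInt : LocallyIntegrable u volume
  weakGrad : HasWeakGradOn n u G Ω
  dirichletFin : IntegrableOn (fun x => ‖G x‖ ^ 2) Ω volume
  measE : MeasurableSet E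
  perFin : fracPer n σ E Ω ≠ ∞
  nonnegOnE : ∀ᵐ x ∂(volume : Measure (Pt n)), x ∈ E → 0 ≤ u x
  nonposOffE : ∀ᵐ x ∂(volume : Measure (Pt n)), x ∉ E → u x ≤ 0

/-- The energy functional `E_Ω(u,E)` (with `G` the weak gradient of `u` on `Ω`). -/
def energyF (n : ℕ) (σ : ℝ) (Φ : ℝ → ℝ) (Ω : Set (Pt n)) (G : Pt n → Pt n)
    (E : Set (Pt n)) : ℝ :=
  (∫ x in Ω, ‖G x‖ ^ 2) + Φ ((fracPer n σ E Ω).toReal)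

/-- `(u,E)`, with weak gradient `G`, minimizes the energy in `Ω` among admissible
competitors with the same exterior data. -/
def MinimizesIn (n : ℕ) (σ : ℝ) (Φ : ℝ → ℝ) (Ω : Set (Pt n)) (u : Pt n → ℝ)
    (G : Pt n → Pt n) (E : Set (Pt n)) : Prop :=
  AdmissiblePair n σ Ω u G E ∧
  ∀ (v : Pt n → ℝ) (Gv : Pt n → Pt n) (F : Set (Pt n)),
    AdmissiblePair n σ Ω v Gv F →
    (∀ᵐ x ∂(volume : Measure (Pt n)), x ∉ Ω → v x = u x) →
    ZeroExtGradL2 n Ω (fun x => v x - u x) →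
    volume ((F \ Ω) ∆ (E \ Ω)) = 0 →
    energyF n σ Φ Ω G E ≤ energyF n σ Φ Ω Gv F

/-- `(u,E)` is a minimal pair in `Ω`. -/
def IsMinimalPair (n : ℕ) (σ : ℝ) (Φ : ℝ → ℝ) (Ω : Set (Pt n)) (u : Pt n → ℝ)
    (E : Set (Pt n)) : Prop :=
  ∃ G : Pt n → Pt n, MinimizesIn n σ Φ Ω u G E

/-- `ũ(x,y) = xy`. -/
def tildeU : Pt 2 → ℝ := fun p => p 0 * p 1

/-- `Ẽ = {(x,y) : xy > 0}`. -/
def tildeE : Set (Pt 2) := {p : Pt 2 | 0 < p 0 * p 1}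

/-- `∇ũ(x,y) = (y,x)`. -/
def tildeG : Pt 2 → Pt 2 := fun p => (WithLp.equiv 2 (Fin 2 → ℝ)).symm ![p 1, p 0]

/-- The precise representative `û` of a locally integrable function. -/
def preciseRep (n : ℕ) (u : Pt n → ℝ) (x : Pt n) : ℝ :=
  limsup (fun ε : ℝ => (volume (ball x ε)).toReal⁻¹ * ∫ y in ball x ε, u y)
    (𝓝[>] (0 : ℝ))

/-- Membership in the set `𝒰₀`. -/
def memU0 (n : ℕ) (Ω : Set (Pt n)) (u : Pt n → ℝ) (p : Pt n) : Prop :=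
  p ∈ Ω ∧ ∃ xs : ℕ → Pt n, (∀ k, xs k ∈ Ω) ∧ Tendsto xs atTop (𝓝 p) ∧
    Tendsto (fun k => preciseRep n u (xs k)) atTop (𝓝 (0 : ℝ))

end

theorem measurable_kernel (n : ℕ) (σ : ℝ) :
    Measurable fun p : Pt n × Pt n => ENNReal.ofReal (‖p.1 - p.2‖ ^ (-((n : ℝ) + σ))) := by
  fun_prop

theorem measurable_inner_kernel (n : ℕ) (σ : ℝ) (B : Set (Pt n)) :
    Measurable fun x : Pt n => ∫⁻ y in B, ENNReal.ofReal (‖x - y‖ ^ (-((n : ℝ) + σ))) :=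
  (measurable_kernel n σ).lintegral_prod_right'

theorem interL_comm (n : ℕ) (σ : ℝ) (A B : Set (Pt n)) : interL n σ A B = interL n σ B A := by
  unfold interL
  rw [lintegral_lintegral_swap (measurable_kernel n σ).aemeasurable]
  simp_rw [norm_sub_rev]

theorem interL_mono {n : ℕ} {σ : ℝ} {A A' B B' : Set (Pt n)} (hA : A ⊆ A') (hB : B ⊆ B') :
    interL n σ A B ≤ interL n σ A' B' :=
  (lintegral_mono_set hA).trans (lintegral_mono fun _ => lintegral_mono_set hB)

theorem interL_congr_right {n : ℕ} {σ : ℝ} (A : Set (Pt n)) {B B' : Set (Pt n)}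
    (hB : B =ᵐ[volume] B') : interL n σ A B = interL n σ A B' := by
  unfold interL
  simp_rw [setLIntegral_congr hB]

theorem interL_union_left {n : ℕ} {σ : ℝ} {A A' : Set (Pt n)} (B : Set (Pt n))
    (hA' : MeasurableSet A') (h : Disjoint A A') :
    interL n σ (A ∪ A') B = interL n σ A B + interL n σ A' B :=
  lintegral_union hA' h

theorem interL_union_right {n : ℕ} {σ : ℝ} (A : Set (Pt n)) {B C : Set (Pt n)}
    (hC : MeasurableSet C) (h : Disjoint B C) :
    interL n σ A (B ∪ C) = interL n σ A B + interL n σ A C := by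
  rw [interL_comm, interL_union_left _ hC h, interL_comm, interL_comm n σ C]

/-- The interaction functional is invariant under isometries. -/
theorem interL_preimage_isometryEquiv {n : ℕ} {σ : ℝ} (g : Pt n ≃ᵢ Pt n)
    (hg : MeasurePreserving g volume volume) (A B : Set (Pt n)) :
    interL n σ (g ⁻¹' A) (g ⁻¹' B) = interL n σ A B := by
  have he : MeasurableEmbedding g := g.toHomeomorph.measurableEmbedding
  unfold interL
  rw [← hg.setLIntegral_comp_preimage_emb he _ A]
  refine lintegral_congr fun x => ?_
  rw [← hg.setLIntegral_comp_preimage_emb he _ B]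
  simp_rw [← dist_eq_norm, g.dist_eq]

theorem setLIntegral_preimage_smul {n : ℕ} {r : ℝ} (hr : 0 < r) (f : Pt n → ℝ≥0∞)
    (A : Set (Pt n)) :
    ∫⁻ x in A, f x = ENNReal.ofReal (r ^ n) * ∫⁻ x in (r • ·) ⁻¹' A, f (r • x) := by
  have he : MeasurableEmbedding (fun x : Pt n => r • x) :=
    (Homeomorph.smulOfNeZero r hr.ne').measurableEmbedding
  have h := Measure.map_addHaar_smul (volume : Measure (Pt n)) hr.ne'
  rw [← he.lintegral_map, ← he.restrict_map, h, Measure.restrict_smul, lintegral_smul_measure,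
    finrank_euclideanSpace_fin, smul_eq_mul, ← mul_assoc, ← ENNReal.ofReal_mul (by positivity),
    abs_of_pos (by positivity), mul_inv_cancel₀ (by positivity), ENNReal.ofReal_one, one_mul]

theorem interL_scale {n : ℕ} {σ r : ℝ} (hr : 0 < r) (A B : Set (Pt n)) :
    interL n σ A B
      = ENNReal.ofReal (r ^ ((n : ℝ) - σ)) * interL n σ ((r • ·) ⁻¹' A) ((r • ·) ⁻¹' B) := by
  unfold interL
  rw [setLIntegral_preimage_smul hr]
  have key : ∀ x : Pt n, ∫⁻ y in B, ENNReal.ofReal (‖r • x - y‖ ^ (-((n : ℝ) + σ)))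
      = ENNReal.ofReal (r ^ (-σ)) *
        ∫⁻ y in (r • ·) ⁻¹' B, ENNReal.ofReal (‖x - y‖ ^ (-((n : ℝ) + σ))) := by
    intro x
    rw [setLIntegral_preimage_smul hr]
    simp_rw [← smul_sub, norm_smul, Real.norm_of_nonneg hr.le,
      Real.mul_rpow hr.le (norm_nonneg _)]
    simp_rw [ENNReal.ofReal_mul (Real.rpow_nonneg hr.le _)]
    rw [lintegral_const_mul' _ _ ENNReal.ofReal_ne_top, ← mul_assoc,
      ← ENNReal.ofReal_mul (by positivity), ← Real.rpow_natCast, ← Real.rpow_add hr]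
    congr 3
    ring
  simp_rw [key]
  rw [lintegral_const_mul' _ _ ENNReal.ofReal_ne_top, ← mul_assoc,
      ← ENNReal.ofReal_mul (by positivity), ← Real.rpow_natCast, ← Real.rpow_add hr]
  congr 2

theorem fracPer_scale {n : ℕ} {σ r : ℝ} (hr : 0 < r) (E : Set (Pt n)) :
    fracPer n σ E (ball 0 r)
      = ENNReal.ofReal (r ^ ((n : ℝ) - σ)) * fracPer n σ ((r • ·) ⁻¹' E) (ball 0 1) := by
  have hb : (fun x : Pt n => r • x) ⁻¹' ball 0 r = ball 0 1 := by
    ext x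
    simp [norm_smul, abs_of_pos hr, hr]
  unfold fracPer
  rw [interL_scale hr, interL_scale hr (Eᶜ ∩ _), ← mul_add]
  simp only [preimage_inter, preimage_compl, hb]

/-- The change of the fractional perimeter in `D` when a set `T ⊆ D \ E` is added to `E`. -/
theorem fracPer_union {n : ℕ} {σ : ℝ} {E T D : Set (Pt n)} (hE : MeasurableSet E)
    (hT : MeasurableSet T) (hD : MeasurableSet D) (hTD : T ⊆ D) (hTE : Disjoint E T) :
    fracPer n σ E D + interL n σ T (E ∪ T)ᶜ = fracPer n σ (E ∪ T) D + interL n σ T E := by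
  have e1 : Eᶜ = (E ∪ T)ᶜ ∪ T := by
    ext x
    have := fun h : x ∈ E => disjoint_left.1 hTE h
    simp; tauto
  have e2 : Eᶜ ∩ D = ((E ∪ T)ᶜ ∩ D) ∪ T := by
    ext x
    have := fun h : x ∈ E => disjoint_left.1 hTE h
    have := @hTD x
    simp; tauto
  have e3 : (E ∪ T) ∩ Dᶜ = E ∩ Dᶜ := by
    ext x
    have := @hTD x
    simp; tauto
  have e4 : (E ∪ T) ∩ D = (E ∩ D) ∪ T := by
    ext x
    have := @hTD x
    simp; tauto
  have e5 : E = (E ∩ D) ∪ (E ∩ Dᶜ) := by simp [← inter_union_distrib_left]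
  have h1 : interL n σ (E ∩ D) Eᶜ
      = interL n σ (E ∩ D) (E ∪ T)ᶜ + interL n σ (E ∩ D) T := by
    rw [e1, interL_union_right _ hT (disjoint_compl_left.mono_right subset_union_right)]
  have h2 : interL n σ (Eᶜ ∩ D) (E ∩ Dᶜ)
      = interL n σ ((E ∪ T)ᶜ ∩ D) (E ∩ Dᶜ) + interL n σ T (E ∩ Dᶜ) := by
    rw [e2, interL_union_left _ hT (disjoint_left.2 fun x hx hx' => hx.1 (Or.inr hx'))]
  have h3 : interL n σ ((E ∪ T) ∩ D) (E ∪ T)ᶜ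
      = interL n σ (E ∩ D) (E ∪ T)ᶜ + interL n σ T (E ∪ T)ᶜ := by
    rw [e4, interL_union_left _ hT (hTE.mono_left inter_subset_left)]
  have h4 : interL n σ T E = interL n σ (E ∩ D) T + interL n σ T (E ∩ Dᶜ) := by
    conv_lhs => rw [e5]
    rw [interL_union_right _ (hE.inter hD.compl)
      (disjoint_left.2 fun x hx hx' => hx'.2 hx.2), interL_comm n σ T]
  unfold fracPer
  rw [h1, h2, h3, h4, e3]
  ring

/-- Adding to `E` a set which interacts more with `E` than with the remaining complement strictly
decreases the fractional perimeter. -/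
theorem fracPer_union_lt {n : ℕ} {σ : ℝ} {E T D : Set (Pt n)} (hE : MeasurableSet E)
    (hT : MeasurableSet T) (hD : MeasurableSet D) (hTD : T ⊆ D) (hTE : Disjoint E T)
    (hfin : fracPer n σ E D ≠ ∞) (hlt : interL n σ T (E ∪ T)ᶜ < interL n σ T E) :
    fracPer n σ (E ∪ T) D < fracPer n σ E D := by
  have h := fracPer_union (σ := σ) hE hT hD hTD hTE
  by_contra! hle
  have : fracPer n σ E D + interL n σ T (E ∪ T)ᶜ < fracPer n σ (E ∪ T) D + interL n σ T E :=
    (ENNReal.add_lt_add_left hfin hlt).trans_le (by gcongr)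
  exact this.ne h

theorem measurable_coord {n : ℕ} (i : Fin n) : Measurable fun p : Pt n => p i := by fun_prop

/-- Coordinate hyperplanes are null sets. -/
theorem ae_coord_ne {n : ℕ} (i : Fin n) (c : ℝ) : ∀ᵐ p : Pt n, p i ≠ c := by
  have h := (PiLp.volume_preserving_ofLp (Fin n)).quasiMeasurePreserving.ae
    (Measure.ae_eval_ne (μ := fun _ : Fin n => (volume : Measure ℝ)) i c)
  simpa using h

/-- The reflection of the `i`-th coordinate, followed by a translation by `c`. -/
noncomputable def coordReflection {n : ℕ} (i : Fin n) (c : Pt n) : Pt n ≃ᵢ Pt n :=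
  (LinearIsometryEquiv.piLpCongrRight 2
    (fun j : Fin n => if j = i then LinearIsometryEquiv.neg ℝ
      else LinearIsometryEquiv.refl ℝ ℝ)).toIsometryEquiv.trans (IsometryEquiv.addRight c)

theorem coordReflection_same {n : ℕ} (i : Fin n) (c p : Pt n) :
    coordReflection i c p i = -p i + c i := by
  simp [coordReflection]

theorem coordReflection_of_ne {n : ℕ} {i j : Fin n} (h : j ≠ i) (c p : Pt n) :
    coordReflection i c p j = p j + c j := by
  simp [coordReflection, h]

theorem measurePreserving_coordReflection {n : ℕ} (i : Fin n) (c : Pt n) :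
    MeasurePreserving (coordReflection i c) volume volume :=
  (measurePreserving_add_right volume c).comp (LinearIsometryEquiv.measurePreserving _)

theorem measurableSet_tildeE : MeasurableSet tildeE :=
  measurableSet_lt measurable_const ((measurable_coord 0).mul (measurable_coord 1))

/-- The open square of side `1/4` in the second quadrant with a vertex at the origin. -/
def upperSquare : Set (Pt 2) := {p | (-(1 / 4) < p 0 ∧ p 0 < 0) ∧ (0 < p 1 ∧ p 1 < 1 / 4)}

/-- The open square of side `1/4` in the fourth quadrant with a vertex at the origin. -/
def lowerSquare : Set (Pt 2) := {p | (0 < p 0 ∧ p 0 < 1 / 4) ∧ (-(1 / 4) < p 1 ∧ p 1 < 0)}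

theorem isOpen_upperSquare : IsOpen upperSquare := by
  have c0 : Continuous fun p : Pt 2 => p 0 := by fun_prop
  have c1 : Continuous fun p : Pt 2 => p 1 := by fun_prop
  exact ((isOpen_lt continuous_const c0).inter (isOpen_lt c0 continuous_const)).inter
    ((isOpen_lt continuous_const c1).inter (isOpen_lt c1 continuous_const))

theorem isOpen_lowerSquare : IsOpen lowerSquare := by
  have c0 : Continuous fun p : Pt 2 => p 0 := by fun_prop
  have c1 : Continuous fun p : Pt 2 => p 1 := by fun_prop
  exact ((isOpen_lt continuous_const c0).inter (isOpen_lt c0 continuous_const)).inter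
    ((isOpen_lt continuous_const c1).inter (isOpen_lt c1 continuous_const))

/-- The square in the second quadrant interacts equally with `tildeE` and with the rest of the
complement of `tildeE`. -/
theorem interL_upperSquare (σ : ℝ) :
    interL 2 σ upperSquare tildeE = interL 2 σ upperSquare (tildeE ∪ upperSquare)ᶜ := by
  have m0 := measurable_coord (n := 2) 0
  have m1 := measurable_coord (n := 2) 1
  let Q1 : Set (Pt 2) := {p | 0 < p 0 ∧ 0 < p 1}
  let Q3l : Set (Pt 2) := {p | p 0 < -(1 / 4) ∧ p 1 < 0}
  let Q3r : Set (Pt 2) := {p | (-(1 / 4) < p 0 ∧ p 0 < 0) ∧ p 1 < 0}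
  let Q2l : Set (Pt 2) := {p | p 0 < -(1 / 4) ∧ 0 < p 1}
  let Q2u : Set (Pt 2) := {p | (-(1 / 4) < p 0 ∧ p 0 < 0) ∧ 1 / 4 < p 1}
  let Q4 : Set (Pt 2) := {p | 0 < p 0 ∧ p 1 < 0}
  have hE : tildeE =ᵐ[volume] (Q1 ∪ Q3l ∪ Q3r : Set (Pt 2)) := by
    filter_upwards [ae_coord_ne 0 0, ae_coord_ne 1 0, ae_coord_ne 0 (-(1 / 4))] with p h0 h1 h2
    refine propext ?_
    change 0 < p 0 * p 1 ↔ (_ ∨ _) ∨ _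
    rw [mul_pos_iff]
    simp only [Q1, Q3l, Q3r, mem_ofPred_eq]
    clear * - h0 h1 h2
    grind
  have hEc : ((tildeE ∪ upperSquare)ᶜ : Set (Pt 2)) =ᵐ[volume] (Q2l ∪ Q4 ∪ Q2u : Set (Pt 2)) := by
    filter_upwards [ae_coord_ne 0 0, ae_coord_ne 1 0, ae_coord_ne 0 (-(1 / 4)),
      ae_coord_ne 1 (1 / 4)] with p h0 h1 h2 h3
    refine propext ?_
    change ¬ (0 < p 0 * p 1 ∨ _) ↔ (_ ∨ _) ∨ _
    rw [mul_pos_iff]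
    simp only [Q2l, Q4, Q2u, upperSquare, mem_ofPred_eq]
    clear * - h0 h1 h2 h3
    grind
  let g := coordReflection (n := 2) 0 !₂[-(1 / 4), 0]
  let h := coordReflection (n := 2) 1 !₂[0, 1 / 4]
  have g0 : ∀ p, g p 0 = -p 0 + -(1 / 4) := fun p => by simp [g, coordReflection_same]
  have g1 : ∀ p, g p 1 = p 1 := fun p => by simp [g, coordReflection_of_ne]
  have h0 : ∀ p, h p 0 = p 0 := fun p => by simp [h, coordReflection_of_ne]
  have h1 : ∀ p, h p 1 = -p 1 + 1 / 4 := fun p => by simp [h, coordReflection_same]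
  have gT : g ⁻¹' upperSquare = upperSquare := by
    ext p
    simp only [upperSquare, mem_preimage, mem_ofPred_eq, g0, g1]
    clear * -
    grind
  have hT : h ⁻¹' upperSquare = upperSquare := by
    ext p
    simp only [upperSquare, mem_preimage, mem_ofPred_eq, h0, h1]
    clear * -
    grind
  have e1 : g ⁻¹' Q1 = Q2l := by
    ext p
    simp only [Q1, Q2l, mem_preimage, mem_ofPred_eq, g0, g1]
    clear * -
    grind
  have e2 : g ⁻¹' Q3l = Q4 := by
    ext p
    simp only [Q3l, Q4, mem_preimage, mem_ofPred_eq, g0, g1]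
    clear * -
    grind
  have e3 : h ⁻¹' Q3r = Q2u := by
    ext p
    simp only [Q3r, Q2u, mem_preimage, mem_ofPred_eq, h0, h1]
    clear * -
    grind
  have hg := fun A => interL_preimage_isometryEquiv (σ := σ) g
    (measurePreserving_coordReflection _ _) upperSquare A
  have hh := fun A => interL_preimage_isometryEquiv (σ := σ) h
    (measurePreserving_coordReflection _ _) upperSquare A
  rw [gT] at hg
  rw [hT] at hh
  have mQ3l : MeasurableSet Q3l :=
    (measurableSet_lt m0 measurable_const).inter (measurableSet_lt m1 measurable_const)
  have mQ3r : MeasurableSet Q3r :=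
    ((measurableSet_lt measurable_const m0).inter (measurableSet_lt m0 measurable_const)).inter
      (measurableSet_lt m1 measurable_const)
  have mQ4 : MeasurableSet Q4 :=
    (measurableSet_lt measurable_const m0).inter (measurableSet_lt m1 measurable_const)
  have mQ2u : MeasurableSet Q2u :=
    ((measurableSet_lt measurable_const m0).inter (measurableSet_lt m0 measurable_const)).inter
      (measurableSet_lt measurable_const m1)
  rw [interL_congr_right _ hE, interL_congr_right _ hEc, interL_union_right _ mQ3r,
    interL_union_right _ mQ3l, interL_union_right _ mQ2u, interL_union_right _ mQ4,
    ← hg Q1, ← hg Q3l, ← hh Q3r, e1, e2, e3]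
  all_goals
    refine disjoint_left.2 fun p => ?_
    simp only [Q1, Q3l, Q3r, Q2l, Q2u, Q4, mem_union, mem_ofPred_eq]
    clear * -
    grind

theorem interL_pos {n : ℕ} {σ : ℝ} {A B : Set (Pt n)} (hA : volume A ≠ 0) (hB : volume B ≠ 0)
    (hAB : Disjoint A B) :
    0 < interL n σ A B := by
  unfold interL
  have hm := measurable_inner_kernel n σ B
  rw [setLIntegral_pos_iff hm]
  refine (pos_iff_ne_zero.2 hA).trans_le (measure_mono fun x hx => ⟨?_, hx⟩)
  refine Function.mem_support.2 (ne_of_gt ?_)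
  have hk : Measurable fun y : Pt n => ENNReal.ofReal (‖x - y‖ ^ (-((n : ℝ) + σ))) := by fun_prop
  rw [setLIntegral_pos_iff hk]
  refine (pos_iff_ne_zero.2 hB).trans_le (measure_mono fun y hy => ⟨?_, hy⟩)
  have hxy : x - y ≠ 0 := sub_ne_zero.2 fun h => disjoint_left.1 hAB hx (h ▸ hy)
  simp only [Function.mem_support, ne_eq, ENNReal.ofReal_eq_zero, not_le]
  positivity

theorem disjoint_upperSquare_lowerSquare : Disjoint upperSquare lowerSquare :=
  disjoint_left.2 fun _ hp hq => (hp.1.2.trans hq.1.1).false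

/-- `tildeE` with two small squares at the origin added. -/
def joinedE : Set (Pt 2) := tildeE ∪ (upperSquare ∪ lowerSquare)

theorem tildeE_disjoint_squares : Disjoint tildeE (upperSquare ∪ lowerSquare) := by
  refine disjoint_left.2 fun p hp => ?_
  have hp : 0 < p 0 * p 1 := hp
  rw [mul_pos_iff] at hp
  simp only [upperSquare, lowerSquare, mem_union, mem_ofPred_eq]
  grind

theorem squares_subset_ball : upperSquare ∪ lowerSquare ⊆ ball 0 (1 / 2) := by
  intro p hp
  have h : (p 0) ^ 2 + (p 1) ^ 2 < (1 / 2) ^ 2 := by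
    rcases hp with ⟨⟨_, _⟩, _, _⟩ | ⟨⟨_, _⟩, _, _⟩ <;> nlinarith
  rw [mem_ball_zero_iff, EuclideanSpace.norm_eq, Real.sqrt_lt' (by norm_num)]
  simpa [Fin.sum_univ_two] using h

theorem fracPer_joinedE_lt {σ : ℝ} (hfin : fracPer 2 σ tildeE (ball 0 1) ≠ ∞) :
    fracPer 2 σ joinedE (ball 0 1) < fracPer 2 σ tildeE (ball 0 1) := by
  have mU := isOpen_upperSquare.measurableSet
  have mL := isOpen_lowerSquare.measurableSet
  have hsub : upperSquare ∪ lowerSquare ⊆ ball (0 : Pt 2) 1 :=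
    squares_subset_ball.trans (ball_subset_ball (by norm_num))
  refine fracPer_union_lt measurableSet_tildeE (mU.union mL) measurableSet_ball hsub
    tildeE_disjoint_squares hfin ?_
  let N := LinearIsometryEquiv.neg ℝ (E := Pt 2)
  have hN := interL_preimage_isometryEquiv (σ := σ) N.toIsometryEquiv
    (LinearIsometryEquiv.measurePreserving N)
  have NU : N.toIsometryEquiv ⁻¹' upperSquare = lowerSquare := by
    ext p
    simp only [N, upperSquare, lowerSquare, mem_preimage, mem_ofPred_eq]
    simp
    grind
  have NL : N.toIsometryEquiv ⁻¹' lowerSquare = upperSquare := by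
    ext p
    simp only [N, upperSquare, lowerSquare, mem_preimage, mem_ofPred_eq]
    simp
    grind
  have NE : N.toIsometryEquiv ⁻¹' tildeE = tildeE := by
    ext p
    simp [N, tildeE]
  have h1 := hN upperSquare tildeE
  have h2 := hN upperSquare (tildeE ∪ (upperSquare ∪ lowerSquare))ᶜ
  rw [preimage_compl, preimage_union, preimage_union, NE, NU, NL, union_comm lowerSquare] at h2
  rw [NE, NU] at h1
  rw [interL_union_left _ mL disjoint_upperSquare_lowerSquare,
    interL_union_left _ mL disjoint_upperSquare_lowerSquare, h1, h2]
  have hsplit : (tildeE ∪ upperSquare)ᶜ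
      = (tildeE ∪ (upperSquare ∪ lowerSquare))ᶜ ∪ lowerSquare := by
    ext p
    have : p ∈ tildeE → p ∉ _ := fun h => disjoint_left.1 tildeE_disjoint_squares h
    have : p ∈ upperSquare → p ∉ _ :=
      fun h => disjoint_left.1 disjoint_upperSquare_lowerSquare h
    simp only [mem_compl_iff, mem_union] at *
    tauto
  have hlt : interL 2 σ upperSquare (tildeE ∪ (upperSquare ∪ lowerSquare))ᶜ
      < interL 2 σ upperSquare tildeE := by
    have hne : interL 2 σ upperSquare tildeE ≠ ∞ := by
      have hU : upperSquare ⊆ tildeEᶜ := fun p hp hpE =>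
        disjoint_left.1 tildeE_disjoint_squares hpE (Or.inl hp)
      have hUb : upperSquare ⊆ ball (0 : Pt 2) 1 := subset_union_left.trans hsub
      have e5 : tildeE = (tildeE ∩ ball 0 1) ∪ (tildeE ∩ (ball 0 1)ᶜ) := by
        simp [← inter_union_distrib_left]
      refine ne_top_of_le_ne_top hfin ?_
      rw [e5, interL_union_right _ (measurableSet_tildeE.inter measurableSet_ball.compl)
        (disjoint_left.2 fun x hx hx' => hx'.2 hx.2), ← e5, interL_comm]
      exact add_le_add (interL_mono le_rfl hU)
        (interL_mono (subset_inter hU hUb) le_rfl)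
    have heq := interL_upperSquare σ
    rw [hsplit, interL_union_right _ mL
      (disjoint_compl_left.mono_right (subset_union_right.trans subset_union_right))] at heq
    rw [heq] at hne ⊢
    have hpos : 0 < interL 2 σ upperSquare lowerSquare := by
      refine interL_pos ?_ ?_ disjoint_upperSquare_lowerSquare
      · exact (isOpen_upperSquare.measure_pos volume
          ⟨!₂[-(1 / 8), 1 / 8], by norm_num [upperSquare]⟩).ne'
      · exact (isOpen_lowerSquare.measure_pos volume
          ⟨!₂[1 / 8, -(1 / 8)], by norm_num [lowerSquare]⟩).ne'
    exact ENNReal.lt_add_right (ENNReal.add_ne_top.1 hne).1 hpos.ne'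
  exact ENNReal.add_lt_add hlt hlt

theorem tail_kernel_ne_top (n : ℕ) {σ : ℝ} (hσ : 0 < σ) :
    ∫⁻ z in {z : Pt n | 1 ≤ ‖z‖}, ENNReal.ofReal (‖z‖ ^ (-((n : ℝ) + σ))) ≠ ∞ := by
  have hfin := finite_integral_one_add_norm (E := Pt n) (μ := volume) (r := (n : ℝ) + σ)
    (by rw [finrank_euclideanSpace_fin]; linarith)
  have hm : MeasurableSet {z : Pt n | 1 ≤ ‖z‖} := measurableSet_le measurable_const measurable_norm
  have hs : 0 ≤ (n : ℝ) + σ := by positivity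
  have hle : ∫⁻ z in {z : Pt n | 1 ≤ ‖z‖}, ENNReal.ofReal (‖z‖ ^ (-((n : ℝ) + σ)))
      ≤ ENNReal.ofReal (2 ^ ((n : ℝ) + σ)) *
        ∫⁻ z : Pt n, ENNReal.ofReal ((1 + ‖z‖) ^ (-((n : ℝ) + σ))) := by
    rw [← lintegral_const_mul' _ _ ENNReal.ofReal_ne_top]
    refine (setLIntegral_mono' hm fun z (hz : 1 ≤ ‖z‖) => ?_).trans (setLIntegral_le_lintegral _ _)
    rw [← ENNReal.ofReal_mul (by positivity)]
    refine ENNReal.ofReal_le_ofReal ?_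
    calc ‖z‖ ^ (-((n : ℝ) + σ)) ≤ ((1 + ‖z‖) / 2) ^ (-((n : ℝ) + σ)) :=
          Real.rpow_le_rpow_of_nonpos (by positivity) (by linarith) (by linarith)
      _ = 2 ^ ((n : ℝ) + σ) * (1 + ‖z‖) ^ (-((n : ℝ) + σ)) := by
          rw [Real.div_rpow (by positivity) (by norm_num), Real.rpow_neg (by norm_num : (0:ℝ) ≤ 2),
            div_inv_eq_mul, mul_comm]
  exact ne_top_of_le_ne_top (ENNReal.mul_ne_top ENNReal.ofReal_ne_top hfin.ne) hle

theorem lintegral_kernel_away {n : ℕ} {σ d : ℝ} (hd : 0 < d) (x : Pt n) :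
    ∫⁻ y in {y | d ≤ ‖x - y‖}, ENNReal.ofReal (‖x - y‖ ^ (-((n : ℝ) + σ)))
      = ENNReal.ofReal (d ^ (-σ)) *
        ∫⁻ z in {z : Pt n | 1 ≤ ‖z‖}, ENNReal.ofReal (‖z‖ ^ (-((n : ℝ) + σ))) := by
  have hmp : MeasurePreserving (fun y : Pt n => x - y) volume volume :=
    Measure.measurePreserving_sub_left volume x
  have he : MeasurableEmbedding (fun y : Pt n => x - y) :=
    (Homeomorph.subLeft x).measurableEmbedding
  have h1 := hmp.setLIntegral_comp_preimage_emb he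
    (fun z => ENNReal.ofReal (‖z‖ ^ (-((n : ℝ) + σ)))) {z | d ≤ ‖z‖}
  have hpre : (fun z : Pt n => d • z) ⁻¹' {z | d ≤ ‖z‖} = {z | 1 ≤ ‖z‖} := by
    ext z
    simp [norm_smul, abs_of_pos hd, hd]
  refine h1.trans ?_
  rw [setLIntegral_preimage_smul hd, hpre]
  simp_rw [norm_smul, Real.norm_of_nonneg hd.le, Real.mul_rpow hd.le (norm_nonneg _),
    ENNReal.ofReal_mul (Real.rpow_nonneg hd.le _)]
  rw [lintegral_const_mul' _ _ ENNReal.ofReal_ne_top, ← mul_assoc,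
      ← ENNReal.ofReal_mul (by positivity), ← Real.rpow_natCast, ← Real.rpow_add hd]
  congr 3
  ring

theorem lintegral_abs_rpow_ne_top {σ : ℝ} (hσ : σ < 1) :
    ∫⁻ t in Ioc (-1 : ℝ) 1, ENNReal.ofReal (|t| ^ (-σ)) ≠ ∞ := by
  have h1 : IntervalIntegrable (fun t : ℝ => |t| ^ (-σ)) volume 0 1 := by
    refine (intervalIntegral.intervalIntegrable_rpow' (r := -σ) (by linarith)).congr
      fun t ht => ?_
    rw [uIoc_of_le zero_le_one] at ht
    simp [abs_of_pos ht.1]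
  have h2 : IntervalIntegrable (fun t : ℝ => |t| ^ (-σ)) volume (-1) 0 := by
    have := ((IntervalIntegrable.iff_comp_neg (by simp)).1 h1).symm
    simpa using this
  have h3 := (intervalIntegrable_iff_integrableOn_Ioc_of_le (by norm_num)).1 (h2.trans h1)
  refine ne_of_lt ((lintegral_mono fun t => ?_).trans_lt h3.2)
  rw [Real.enorm_eq_ofReal (by positivity)]

theorem lintegral_ball_coord_ne_top {σ : ℝ} (hσ : σ < 1) {n : ℕ} (i : Fin n) :
    ∫⁻ x in ball (0 : Pt n) 1, ENNReal.ofReal (|x i| ^ (-σ)) ≠ ∞ := by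
  let C : Set (Fin n → ℝ) := univ.pi fun _ => Ioc (-1 : ℝ) 1
  have hsub : ball (0 : Pt n) 1 ⊆ WithLp.ofLp ⁻¹' C := by
    intro x hx j _
    have h := (PiLp.norm_apply_le x j).trans_lt (mem_ball_zero_iff.1 hx)
    rw [Real.norm_eq_abs, abs_lt] at h
    exact ⟨h.1, h.2.le⟩
  have he : MeasurableEmbedding (WithLp.ofLp : Pt n → (Fin n → ℝ)) :=
    (MeasurableEquiv.toLp 2 (Fin n → ℝ)).symm.measurableEmbedding
  refine ne_top_of_le_ne_top ?_ (lintegral_mono_set hsub)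
  have hf : Measurable fun t : ℝ => ENNReal.ofReal (|t| ^ (-σ)) := by fun_prop
  have h1 := (PiLp.volume_preserving_ofLp (Fin n)).setLIntegral_comp_preimage_emb he
    (fun y => ENNReal.ofReal (|y i| ^ (-σ))) C
  rw [h1, volume_pi, Measure.restrict_pi_pi]
  have h2 : ∫⁻ y : Fin n → ℝ, ENNReal.ofReal (|y i| ^ (-σ))
        ∂(Measure.pi fun _ => volume.restrict (Ioc (-1 : ℝ) 1))
      = ∫⁻ t, ENNReal.ofReal (|t| ^ (-σ))
        ∂((Measure.pi fun _ : Fin n => volume.restrict (Ioc (-1 : ℝ) 1)).map (Function.eval i)) :=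
    (lintegral_map hf (measurable_pi_apply i)).symm
  rw [h2, Measure.pi_map_eval, lintegral_smul_measure]
  refine ENNReal.mul_ne_top ?_ (lintegral_abs_rpow_ne_top hσ)
  simp

theorem abs_le_norm_sub_of_mul_nonpos {n : ℕ} {x y : Pt n} {i : Fin n} (h : x i * y i ≤ 0) :
    |x i| ≤ ‖x - y‖ := by
  refine le_trans ?_ (PiLp.norm_apply_le (x - y) i)
  rw [Real.norm_eq_abs, PiLp.sub_apply]
  refine sq_le_sq.1 ?_
  nlinarith [sq_nonneg (y i)]

/-- The interaction of a part of the unit ball with a set separated from it by the axes is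
finite. -/
theorem interL_ball_ne_top {σ : ℝ} (hσ : σ ∈ Ioo (0 : ℝ) 1) {A B : Set (Pt 2)}
    (hAm : MeasurableSet A) (hA : A ⊆ ball 0 1)
    (hAB : ∀ x ∈ A, ∀ y ∈ B, x 0 * y 0 ≤ 0 ∨ x 1 * y 1 ≤ 0) :
    interL 2 σ A B ≠ ∞ := by
  set C := ∫⁻ z in {z : Pt 2 | 1 ≤ ‖z‖}, ENNReal.ofReal (‖z‖ ^ (-(((2 : ℕ) : ℝ) + σ))) with hC
  have hCt : C ≠ ∞ := tail_kernel_ne_top 2 hσ.1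
  have hle : interL 2 σ A B ≤ ∫⁻ x in ball (0 : Pt 2) 1,
      (ENNReal.ofReal (|x 0| ^ (-σ)) * C + ENNReal.ofReal (|x 1| ^ (-σ)) * C) := by
    refine (setLIntegral_mono_ae' hAm ?_).trans (lintegral_mono_set hA)
    filter_upwards [ae_coord_ne 0 0, ae_coord_ne 1 0] with x h0 h1 hx
    have hsub : B ⊆ {y | |x 0| ≤ ‖x - y‖} ∪ {y | |x 1| ≤ ‖x - y‖} := fun y hy =>
      (hAB x hx y hy).imp abs_le_norm_sub_of_mul_nonpos abs_le_norm_sub_of_mul_nonpos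
    refine ((lintegral_mono_set hsub).trans (lintegral_union_le _ _ _)).trans_eq ?_
    rw [lintegral_kernel_away (abs_pos.2 h0), lintegral_kernel_away (abs_pos.2 h1)]
  refine ne_top_of_le_ne_top ?_ hle
  have hm : ∀ i, Measurable fun x : Pt 2 => ENNReal.ofReal (|x i| ^ (-σ)) := by
    intro i; fun_prop
  rw [lintegral_add_left ((hm 0).mul_const C), lintegral_mul_const _ (hm 0),
    lintegral_mul_const _ (hm 1)]
  exact ENNReal.add_ne_top.2 ⟨ENNReal.mul_ne_top (lintegral_ball_coord_ne_top hσ.2 0) hCt,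
    ENNReal.mul_ne_top (lintegral_ball_coord_ne_top hσ.2 1) hCt⟩

theorem fracPer_tildeE_ne_top {σ : ℝ} (hσ : σ ∈ Ioo (0 : ℝ) 1) :
    fracPer 2 σ tildeE (ball 0 1) ≠ ∞ := by
  have key : ∀ x y : Pt 2, 0 < x 0 * x 1 → y 0 * y 1 ≤ 0 → x 0 * y 0 ≤ 0 ∨ x 1 * y 1 ≤ 0 := by
    intro x y hx hy
    by_contra! h
    nlinarith [mul_pos h.1 h.2]
  refine ENNReal.add_ne_top.2 ⟨interL_ball_ne_top hσ (measurableSet_tildeE.inter measurableSet_ball) inter_subset_right fun x hx y hy => ?_,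
    interL_ball_ne_top hσ (measurableSet_tildeE.compl.inter measurableSet_ball)
      inter_subset_right fun x hx y hy => ?_⟩
  · exact key x y hx.1 (not_lt.1 hy)
  · have := key y x hy.1 (not_lt.1 hx.1)
    rwa [mul_comm (x 0), mul_comm (x 1)]

theorem le_interL {n : ℕ} {σ d : ℝ} (hσ : 0 < σ) {A B : Set (Pt n)} (hA : MeasurableSet A)
    (hB : MeasurableSet B) (hAB : Disjoint A B) (hd : ∀ x ∈ A, ∀ y ∈ B, ‖x - y‖ ≤ d) :
    ENNReal.ofReal (d ^ (-((n : ℝ) + σ))) * volume B * volume A ≤ interL n σ A B := by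
  unfold interL
  rw [← setLIntegral_const]
  refine setLIntegral_mono' hA fun x hx => ?_
  rw [← setLIntegral_const]
  refine setLIntegral_mono' hB fun y hy => ENNReal.ofReal_le_ofReal ?_
  have hxy : x - y ≠ 0 := sub_ne_zero.2 fun h => disjoint_left.1 hAB hx (h ▸ hy)
  exact Real.rpow_le_rpow_of_nonpos (norm_pos_iff.2 hxy) (hd x hx y hy)
    (by have : (0 : ℝ) ≤ n := n.cast_nonneg
        linarith)

/-- A positive lower bound for the perimeter in the unit ball of all sets which agree with
`tildeE` outside of the unit ball. -/
theorem exists_pos_le_fracPer {σ : ℝ} (hσ : 0 < σ) :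
    ∃ c : ℝ, 0 < c ∧ ∀ F : Set (Pt 2), MeasurableSet F →
      volume ((F \ ball 0 1) ∆ (tildeE \ ball 0 1)) = 0 →
      ENNReal.ofReal c ≤ fracPer 2 σ F (ball 0 1) := by
  have c0 : Continuous fun p : Pt 2 => p 0 := by fun_prop
  have c1 : Continuous fun p : Pt 2 => p 1 := by fun_prop
  let S : Set (Pt 2) := ball 0 2 \ closedBall 0 1
  have hS : IsOpen S := isOpen_ball.sdiff isClosed_closedBall
  let P : Set (Pt 2) := {p | 0 < p 0 * p 1} ∩ S
  let N : Set (Pt 2) := {p | p 0 * p 1 < 0} ∩ S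
  have hP : IsOpen P := (isOpen_lt continuous_const (c0.mul c1)).inter hS
  have hN : IsOpen N := (isOpen_lt (c0.mul c1) continuous_const).inter hS
  have hPpos : 0 < volume P := by
    refine hP.measure_pos volume ⟨!₂[1, 1], by norm_num, ?_⟩
    simp only [S, Set.mem_sdiff, mem_ball_zero_iff, mem_closedBall_zero_iff, EuclideanSpace.norm_eq,
      Real.sqrt_lt' (two_pos), Real.sqrt_le_iff, Fin.sum_univ_two]
    norm_num
  have hNpos : 0 < volume N := by
    refine hN.measure_pos volume ⟨!₂[1, -1], by norm_num, ?_⟩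
    simp only [S, Set.mem_sdiff, mem_ball_zero_iff, mem_closedBall_zero_iff, EuclideanSpace.norm_eq,
      Real.sqrt_lt' (two_pos), Real.sqrt_le_iff, Fin.sum_univ_two]
    norm_num
  let κ := ENNReal.ofReal ((3 : ℝ) ^ (-(((2 : ℕ) : ℝ) + σ)))
  have hκ : κ ≠ 0 := by
    simp only [κ, ne_eq, ENNReal.ofReal_eq_zero, not_le]
    positivity
  let m := min (volume P) (volume N)
  have hm : m ≠ 0 := (lt_min hPpos hNpos).ne'
  have hmt : m ≠ ∞ := by
    refine ne_top_of_le_ne_top ?_ (min_le_left _ _)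
    exact ne_top_of_le_ne_top measure_ball_lt_top.ne
      (measure_mono (inter_subset_right.trans sdiff_subset : P ⊆ ball 0 2))
  let V := volume (ball (0 : Pt 2) 1)
  have hV : V ≠ 0 := (measure_ball_pos _ _ one_pos).ne'
  have hVt : V ≠ ∞ := measure_ball_lt_top.ne
  have hct : κ * m * V ≠ ∞ :=
    ENNReal.mul_ne_top (ENNReal.mul_ne_top ENNReal.ofReal_ne_top hmt) hVt
  refine ⟨(κ * m * V).toReal, ENNReal.toReal_pos (mul_ne_zero (mul_ne_zero hκ hm) hV) hct,
    fun F hF hFE => ?_⟩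
  rw [ENNReal.ofReal_toReal hct]
  have hdist : ∀ x ∈ ball (0 : Pt 2) 1, ∀ y ∈ S, ‖x - y‖ ≤ 3 := by
    intro x hx y hy
    have h1 := mem_ball_zero_iff.1 hx
    have h2 := mem_ball_zero_iff.1 hy.1
    linarith [norm_sub_le x y]
  have hSb : S ⊆ (ball (0 : Pt 2) 1)ᶜ := fun y hy hy' => hy.2 (ball_subset_closedBall hy')
  have hae : ∀ᵐ p : Pt 2, p ∉ ball (0 : Pt 2) 1 → (p ∈ F ↔ p ∈ tildeE) := by
    have := measure_symmDiff_eq_zero_iff.1 hFE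
    filter_upwards [this] with p hp hpb
    have hp : (p ∈ F ∧ p ∉ ball (0 : Pt 2) 1) = (p ∈ tildeE ∧ p ∉ ball (0 : Pt 2) 1) := hp
    simpa [hpb] using hp
  have hPle : volume P ≤ volume (F ∩ S) := by
    refine measure_mono_ae ?_
    filter_upwards [hae] with p hp hpP
    exact ⟨(hp (hSb hpP.2)).2 hpP.1, hpP.2⟩
  have hNle : volume N ≤ volume (Fᶜ ∩ S) := by
    refine measure_mono_ae ?_
    filter_upwards [hae] with p hp hpN
    refine ⟨fun hpF => ?_, hpN.2⟩
    have h1 : 0 < p 0 * p 1 := (hp (hSb hpN.2)).1 hpF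
    exact h1.not_gt hpN.1
  have hdisj : ∀ A B : Set (Pt 2), Disjoint (A ∩ ball 0 1) (B ∩ S) := fun A B =>
    disjoint_left.2 fun x hx hx' => hSb hx'.2 hx.2
  have h1 : κ * m * volume (F ∩ ball 0 1) ≤ interL 2 σ (F ∩ ball 0 1) Fᶜ := by
    refine le_trans ?_ ((le_interL (d := 3) hσ (hF.inter measurableSet_ball)
      (hF.compl.inter hS.measurableSet) (hdisj _ _)
      fun x hx y hy => hdist x hx.2 y hy.2).trans (interL_mono le_rfl inter_subset_left))
    gcongr
    exact (min_le_right _ _).trans hNle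
  have h2 : κ * m * volume (Fᶜ ∩ ball 0 1) ≤ interL 2 σ (Fᶜ ∩ ball 0 1) (F ∩ (ball 0 1)ᶜ) := by
    refine le_trans ?_ ((le_interL (d := 3) hσ (hF.compl.inter measurableSet_ball)
      (hF.inter hS.measurableSet) (hdisj _ _)
      fun x hx y hy => hdist x hx.2 y hy.2).trans
        (interL_mono le_rfl (inter_subset_inter_right _ hSb)))
    gcongr
    exact (min_le_left _ _).trans hPle
  have hVsplit : V = volume (F ∩ ball 0 1) + volume (Fᶜ ∩ ball 0 1) := by
    rw [inter_comm, inter_comm Fᶜ, ← Set.sdiff_eq, measure_inter_add_sdiff _ hF]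
  rw [hVsplit, mul_add]
  exact add_le_add h1 h2

theorem preimage_smul_tildeE {r : ℝ} (hr : 0 < r) : (r • ·) ⁻¹' tildeE = tildeE := by
  ext p
  have h : r * p 0 * (r * p 1) = r ^ 2 * (p 0 * p 1) := by ring
  simp [tildeE, h, hr]

theorem fracPer_tildeE_ball {σ r : ℝ} (hr : 0 < r) :
    fracPer 2 σ tildeE (ball 0 r)
      = ENNReal.ofReal (r ^ (2 - σ)) * fracPer 2 σ tildeE (ball 0 1) := by
  rw [fracPer_scale hr, preimage_smul_tildeE hr]
  simp

theorem le_fracPer_ball {σ c r : ℝ} (hr : 0 < r)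
    (hc : ∀ F : Set (Pt 2), MeasurableSet F →
      volume ((F \ ball 0 1) ∆ (tildeE \ ball 0 1)) = 0 →
      ENNReal.ofReal c ≤ fracPer 2 σ F (ball 0 1))
    {F : Set (Pt 2)} (hF : MeasurableSet F)
    (hFE : volume ((F \ ball 0 r) ∆ (tildeE \ ball 0 r)) = 0) :
    ENNReal.ofReal (r ^ (2 - σ) * c) ≤ fracPer 2 σ F (ball 0 r) := by
  rw [fracPer_scale hr, ENNReal.ofReal_mul (by positivity)]
  simp only [Nat.cast_ofNat]
  gcongr
  refine hc _ (measurable_const_smul r hF) ?_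
  have hb : (fun x : Pt 2 => r • x) ⁻¹' ball 0 r = ball 0 1 := by
    ext x
    simp [norm_smul, abs_of_pos hr, hr]
  have h : (((r • ·) ⁻¹' F) \ ball 0 1) ∆ (tildeE \ ball 0 1)
      = (r • ·) ⁻¹' ((F \ ball (0 : Pt 2) r) ∆ (tildeE \ ball 0 r)) := by
    rw [preimage_symmDiff, preimage_sdiff, preimage_sdiff, hb, preimage_smul_tildeE hr]
  rw [h, Measure.addHaar_preimage_smul _ hr.ne', hFE, mul_zero]

theorem MeasureTheory.LocallyIntegrableOn.integrable_mul_of_hasCompactSupport {n : ℕ}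
    {U : Set (Pt n)} {f φ : Pt n → ℝ} (hf : LocallyIntegrableOn f U) (hφ : Continuous φ)
    (hc : HasCompactSupport φ) (hs : tsupport φ ⊆ U) : Integrable fun x => f x * φ x := by
  have h : IntegrableOn (fun x => f x * φ x) (tsupport φ) :=
    (hf.integrableOn_compact_subset hs hc).mul_continuousOn hφ.continuousOn hc
  refine (integrableOn_iff_integrable_of_support_subset fun x hx => ?_).1 h
  exact subset_tsupport _ (right_ne_zero_of_mul hx)

theorem MeasureTheory.LocallyIntegrableOn.coord {n : ℕ} {U : Set (Pt n)} {G : Pt n → Pt n}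
    (hG : LocallyIntegrableOn G U) (i : Fin n) : LocallyIntegrableOn (fun x => G x i) U :=
  fun x hx => by
    obtain ⟨t, ht, h⟩ := hG x hx
    exact ⟨t, ht, (EuclideanSpace.proj i : Pt n →L[ℝ] ℝ).integrable_comp h⟩

theorem ContDiff.continuous_fderiv_single {n : ℕ} {f : Pt n → ℝ}
    (hf : ContDiff ℝ (⊤ : ℕ∞) f) (i : Fin n) :
    Continuous fun x => fderiv ℝ f x (EuclideanSpace.single i 1) :=
  (hf.continuous_fderiv (by simp)).clm_apply continuous_const

/-- The gradient of a differentiable function. -/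
noncomputable def classicalGrad {n : ℕ} (f : Pt n → ℝ) (x : Pt n) : Pt n :=
  WithLp.toLp 2 fun i => fderiv ℝ f x (EuclideanSpace.single i 1)

theorem continuous_classicalGrad {n : ℕ} {f : Pt n → ℝ} (hf : ContDiff ℝ (⊤ : ℕ∞) f) :
    Continuous (classicalGrad f) :=
  (PiLp.continuous_toLp 2 _).comp (continuous_pi fun i => hf.continuous_fderiv_single i)

theorem hasWeakGradOn_classicalGrad {n : ℕ} {f : Pt n → ℝ} (hf : ContDiff ℝ (⊤ : ℕ∞) f)
    (U : Set (Pt n)) : HasWeakGradOn n f (classicalGrad f) U := by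
  refine ⟨(continuous_classicalGrad hf).locallyIntegrable.locallyIntegrableOn _,
    fun i φ hφ hc _ => ?_⟩
  have hd := (hf.continuous_fderiv_single i)
  refine integral_mul_fderiv_eq_neg_fderiv_mul_of_integrable ?_ ?_ ?_
    (fun x _ => hf.differentiable (by simp) x) (fun x _ => hφ.differentiable (by simp) x)
  · exact (hd.mul hφ.continuous).integrable_of_hasCompactSupport hc.mul_left
  · exact (hf.continuous.mul (hφ.continuous_fderiv_single i)).integrable_of_hasCompactSupport
      (hc.fderiv_apply ℝ _).mul_left
  · exact (hf.continuous.mul hφ.continuous).integrable_of_hasCompactSupport hc.mul_left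

theorem HasWeakGradOn.mono {n : ℕ} {u : Pt n → ℝ} {G : Pt n → Pt n} {U V : Set (Pt n)}
    (h : HasWeakGradOn n u G U) (hVU : V ⊆ U) : HasWeakGradOn n u G V :=
  ⟨h.1.mono_set hVU, fun i φ hφ hc hs => h.2 i φ hφ hc (hs.trans hVU)⟩

theorem HasWeakGradOn.add {n : ℕ} {u v : Pt n → ℝ} {G H : Pt n → Pt n} {U : Set (Pt n)}
    (hu : LocallyIntegrableOn u U) (hv : LocallyIntegrableOn v U)
    (h : HasWeakGradOn n u G U) (h' : HasWeakGradOn n v H U) :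
    HasWeakGradOn n (fun x => u x + v x) (fun x => G x + H x) U := by
  refine ⟨h.1.add h'.1, fun i φ hφ hc hs => ?_⟩
  have hs' : tsupport (fun x => fderiv ℝ φ x (EuclideanSpace.single i 1)) ⊆ U :=
    (tsupport_fderiv_apply_subset ℝ _).trans hs
  simp only [add_mul, PiLp.add_apply]
  rw [integral_add, integral_add, h.2 i φ hφ hc hs, h'.2 i φ hφ hc hs, neg_add]
  · exact (h.1.coord i).integrable_mul_of_hasCompactSupport hφ.continuous hc hs
  · exact (h'.1.coord i).integrable_mul_of_hasCompactSupport hφ.continuous hc hs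
  · exact hu.integrable_mul_of_hasCompactSupport (hφ.continuous_fderiv_single i)
      (hc.fderiv_apply ℝ _) hs'
  · exact hv.integrable_mul_of_hasCompactSupport (hφ.continuous_fderiv_single i)
      (hc.fderiv_apply ℝ _) hs'

theorem HasWeakGradOn.ae_eq {n : ℕ} {u v : Pt n → ℝ} {G H : Pt n → Pt n} {U : Set (Pt n)}
    (hU : IsOpen U) (huv : EqOn u v U) (h : HasWeakGradOn n u G U) (h' : HasWeakGradOn n v H U) :
    ∀ᵐ x, x ∈ U → G x = H x := by
  have key : ∀ i, ∀ᵐ x, x ∈ U → G x i - H x i = 0 := by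
    intro i
    refine hU.ae_eq_zero_of_integral_contDiff_smul_eq_zero ((h.1.coord i).sub (h'.1.coord i))
      fun φ hφ hc hs => ?_
    have h1 := h.2 i φ hφ hc hs
    have h2 := h'.2 i φ hφ hc hs
    have h3 : ∫ x, u x * fderiv ℝ φ x (EuclideanSpace.single i 1)
        = ∫ x, v x * fderiv ℝ φ x (EuclideanSpace.single i 1) := by
      refine integral_congr_ae (Eventually.of_forall fun x => ?_)
      by_cases hx : x ∈ U
      · simp only [huv hx]
      · have : fderiv ℝ φ x = 0 := fderiv_of_notMem_tsupport _ fun hx' => hx (hs hx')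
        simp [this]
    have hi1 := (h.1.coord i).integrable_mul_of_hasCompactSupport hφ.continuous hc hs
    have hi2 := (h'.1.coord i).integrable_mul_of_hasCompactSupport hφ.continuous hc hs
    calc ∫ x, φ x • (G x i - H x i) = ∫ x, (G x i * φ x - H x i * φ x) := by
          refine integral_congr_ae (Eventually.of_forall fun x => ?_)
          simp only [smul_eq_mul]
          ring
      _ = 0 := by rw [integral_sub hi1 hi2]; linarith
  filter_upwards [ae_all_iff.2 key] with x hx hxU
  ext i
  exact sub_eq_zero.1 (hx i hxU)

theorem contDiff_coord {n : ℕ} (i : Fin n) : ContDiff ℝ (⊤ : ℕ∞) fun p : Pt n => p i :=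
  (EuclideanSpace.proj i : Pt n →L[ℝ] ℝ).contDiff

theorem fderiv_coord {n : ℕ} (i j : Fin n) (x : Pt n) :
    fderiv ℝ (fun p : Pt n => p i) x (EuclideanSpace.single j 1) = if i = j then 1 else 0 := by
  have : fderiv ℝ (fun p : Pt n => p i) x = (EuclideanSpace.proj i : Pt n →L[ℝ] ℝ) :=
    (EuclideanSpace.proj i : Pt n →L[ℝ] ℝ).fderiv
  simp [this]

theorem contDiff_tildeU : ContDiff ℝ (⊤ : ℕ∞) tildeU :=
  (contDiff_coord 0).mul (contDiff_coord 1)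

theorem classicalGrad_tildeU (x : Pt 2) : classicalGrad tildeU x = !₂[x 1, x 0] := by
  have h : fderiv ℝ tildeU x = x 0 • fderiv ℝ (fun p : Pt 2 => p 1) x
      + x 1 • fderiv ℝ (fun p : Pt 2 => p 0) x :=
    fderiv_fun_mul ((contDiff_coord 0).differentiable (by simp) x)
      ((contDiff_coord 1).differentiable (by simp) x)
  ext i
  fin_cases i <;> simp [classicalGrad, h, fderiv_coord]

/-- Weak derivatives of functions vanishing outside of a ball integrate to zero against
smooth functions not depending on the corresponding coordinate. -/
theorem HasWeakGradOn.setIntegral_mul_eq_zero {n : ℕ} {R : ℝ} (hR : 0 < R) {w : Pt n → ℝ}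
    {H : Pt n → Pt n} (h : HasWeakGradOn n w H univ) (hw : ∀ x ∉ ball (0 : Pt n) R, w x = 0)
    {g : Pt n → ℝ} (hg : ContDiff ℝ (⊤ : ℕ∞) g) (i : Fin n)
    (hgi : ∀ x, fderiv ℝ g x (EuclideanSpace.single i 1) = 0) :
    IntegrableOn (fun x => H x i * g x) (ball 0 R) ∧ ∫ x in ball 0 R, H x i * g x = 0 := by
  let b : ContDiffBump (0 : Pt n) := ⟨R, R + 1, hR, by linarith⟩
  let φ : Pt n → ℝ := fun x => b x * g x
  have hφ : ContDiff ℝ (⊤ : ℕ∞) φ := b.contDiff.mul hg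
  have hc : HasCompactSupport φ := b.hasCompactSupport.mul_right
  have hφb : ∀ x ∈ ball (0 : Pt n) R, φ x = g x := fun x hx => by
    simp [φ, b.one_of_mem_closedBall (ball_subset_closedBall hx)]
  have hHφ : Integrable fun x => H x i * φ x :=
    (h.1.coord i).integrable_mul_of_hasCompactSupport hφ.continuous hc (subset_univ _)
  have hzero : ∫ x, w x * fderiv ℝ φ x (EuclideanSpace.single i 1) = 0 := by
    refine integral_eq_zero_of_ae (Eventually.of_forall fun x => ?_)
    by_cases hx : x ∈ ball (0 : Pt n) R
    · have : φ =ᶠ[𝓝 x] g := eventually_of_mem (isOpen_ball.mem_nhds hx) hφb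
      simp [this.fderiv_eq, hgi]
    · simp [hw x hx]
  have hH : ∀ᵐ x, x ∈ (closedBall (0 : Pt n) R)ᶜ → H x = 0 := by
    have h0 : HasWeakGradOn n (fun _ => 0) (fun _ => 0) (closedBall (0 : Pt n) R)ᶜ :=
      ⟨locallyIntegrableOn_zero, fun i φ _ _ _ => by simp⟩
    exact HasWeakGradOn.ae_eq isClosed_closedBall.isOpen_compl
      (fun x hx => hw x fun hx' => hx (ball_subset_closedBall hx')) (h.mono (subset_univ _)) h0
  have hsphere : ∀ᵐ x, x ∉ sphere (0 : Pt n) R :=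
    measure_eq_zero_iff_ae_notMem.1 (Measure.addHaar_sphere_of_ne_zero _ _ hR.ne')
  have heq : ∫ x in ball 0 R, H x i * g x = ∫ x, H x i * φ x := by
    rw [← integral_indicator measurableSet_ball]
    refine integral_congr_ae ?_
    filter_upwards [hH, hsphere] with x hx hxs
    by_cases hxb : x ∈ ball (0 : Pt n) R
    · simp [hxb, hφb x hxb]
    · have : x ∈ (closedBall (0 : Pt n) R)ᶜ := fun hx' =>
        hx'.lt_or_eq.elim hxb hxs
      simp [hxb, hx this]
  refine ⟨hHφ.integrableOn.congr_fun (fun x hx => ?_) measurableSet_ball, ?_⟩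
  · simp only [hφb x hx]
  · have := h.2 i φ hφ hc (subset_univ _)
    rw [heq]
    linarith

/-- The function `tildeU` minimizes the Dirichlet energy in balls. -/
theorem dirichlet_tildeU_le {R : ℝ} (hR : 0 < R) {v : Pt 2 → ℝ} {Gv : Pt 2 → Pt 2}
    (hv : HasWeakGradOn 2 v Gv (ball 0 R))
    (hw : ZeroExtGradL2 2 (ball 0 R) fun x => v x - tildeU x)
    (hvl : LocallyIntegrable v) :
    ∫ x in ball 0 R, ‖classicalGrad tildeU x‖ ^ 2 ≤ ∫ x in ball 0 R, ‖Gv x‖ ^ 2 := by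
  obtain ⟨H, hH, hH2⟩ := hw
  set w := (ball (0 : Pt 2) R).indicator fun x => v x - tildeU x with hwdef
  have hwl : LocallyIntegrable w :=
    (hvl.sub contDiff_tildeU.continuous.locallyIntegrable).indicator measurableSet_ball
  have hw0 : ∀ x ∉ ball (0 : Pt 2) R, w x = 0 := fun x hx => indicator_of_notMem hx _
  have hae : ∀ᵐ x, x ∈ ball (0 : Pt 2) R → Gv x = classicalGrad tildeU x + H x := by
    refine HasWeakGradOn.ae_eq isOpen_ball (fun x hx => ?_) hv
      (HasWeakGradOn.add
        (contDiff_tildeU.continuous.locallyIntegrable.locallyIntegrableOn _)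
        (hwl.locallyIntegrableOn _) (hasWeakGradOn_classicalGrad contDiff_tildeU _)
        (hH.mono (subset_univ _)))
    simp [hwdef, hx]
  obtain ⟨hi0, h0⟩ := hH.setIntegral_mul_eq_zero hR hw0 (contDiff_coord 1) 0
    (fun x => by simp [fderiv_coord])
  obtain ⟨hi1, h1⟩ := hH.setIntegral_mul_eq_zero hR hw0 (contDiff_coord 0) 1
    (fun x => by simp [fderiv_coord])
  have hG : IntegrableOn (fun x => ‖classicalGrad tildeU x‖ ^ 2) (ball 0 R) :=
    (((continuous_classicalGrad contDiff_tildeU).norm.pow 2).continuousOn.integrableOn_compact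
      (isCompact_closedBall 0 R)).mono_set ball_subset_closedBall
  calc ∫ x in ball 0 R, ‖classicalGrad tildeU x‖ ^ 2
      ≤ (∫ x in ball 0 R, ‖classicalGrad tildeU x‖ ^ 2) + ∫ x in ball 0 R, ‖H x‖ ^ 2 :=
        le_add_of_nonneg_right (integral_nonneg fun x => by positivity)
    _ = ∫ x in ball 0 R, (‖classicalGrad tildeU x‖ ^ 2 + ‖H x‖ ^ 2
          + 2 * (H x 0 * x 1 + H x 1 * x 0)) := by
        have hGH : IntegrableOn (fun x => ‖classicalGrad tildeU x‖ ^ 2 + ‖H x‖ ^ 2) (ball 0 R) :=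
          hG.add hH2.integrableOn
        have hi : IntegrableOn (fun x => 2 * (H x 0 * x 1 + H x 1 * x 0)) (ball 0 R) :=
          (hi0.add hi1).const_mul 2
        rw [integral_add hGH hi, integral_add hG hH2.integrableOn, integral_const_mul, integral_add hi0 hi1, h0, h1]
        ring
    _ = ∫ x in ball 0 R, ‖Gv x‖ ^ 2 := by
        refine setIntegral_congr_ae measurableSet_ball ?_
        filter_upwards [hae] with x hx hxb
        rw [hx hxb, classicalGrad_tildeU]
        simp only [EuclideanSpace.norm_sq_eq, Fin.sum_univ_two, PiLp.add_apply, Real.norm_eq_abs,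
          sq_abs]
        simp
        ring

theorem admissiblePair_of_contDiff {σ R : ℝ} {u : Pt 2 → ℝ} {E : Set (Pt 2)}
    (hu : ContDiff ℝ (⊤ : ℕ∞) u) (hE : MeasurableSet E) (hper : fracPer 2 σ E (ball 0 R) ≠ ∞)
    (hpos : ∀ x ∈ E, 0 ≤ u x) (hneg : ∀ x ∉ E, u x ≤ 0) :
    AdmissiblePair 2 σ (ball 0 R) u (classicalGrad u) E where
  locInt := hu.continuous.locallyIntegrable
  weakGrad := hasWeakGradOn_classicalGrad hu _
  dirichletFin := (((continuous_classicalGrad hu).norm.pow 2).continuousOn.integrableOn_compact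
      (isCompact_closedBall 0 R)).mono_set ball_subset_closedBall
  measE := hE
  perFin := hper
  nonnegOnE := Eventually.of_forall hpos
  nonposOffE := Eventually.of_forall hneg

theorem measurableSet_joinedE : MeasurableSet joinedE :=
  measurableSet_tildeE.union
    (isOpen_upperSquare.measurableSet.union isOpen_lowerSquare.measurableSet)

theorem joinedE_sdiff_ball : joinedE \ ball 0 1 = tildeE \ ball 0 1 := by
  have h : upperSquare ∪ lowerSquare ⊆ ball 0 1 :=
    squares_subset_ball.trans (ball_subset_ball (by norm_num))
  rw [joinedE, union_sdiff_distrib, sdiff_eq_empty.2 h, union_empty]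

/-- A smooth function vanishing near the origin, with the same sign as `tildeU`,
and which agrees with `tildeU` outside of the unit ball. -/
noncomputable def cutU (b : ContDiffBump (0 : Pt 2)) (x : Pt 2) : ℝ := (1 - b x) * tildeU x

theorem contDiff_cutU (b : ContDiffBump (0 : Pt 2)) : ContDiff ℝ (⊤ : ℕ∞) (cutU b) :=
  (contDiff_const.sub b.contDiff).mul contDiff_tildeU

theorem tildeU_smul (r : ℝ) (x : Pt 2) : tildeU (r • x) = r ^ 2 * tildeU x := by
  simp only [tildeU, PiLp.smul_apply, smul_eq_mul]
  ring

theorem classicalGrad_rescale {n : ℕ} {f : Pt n → ℝ} (hf : ContDiff ℝ (⊤ : ℕ∞) f) {r : ℝ}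
    (hr : 0 < r) (x : Pt n) :
    classicalGrad (fun x => r ^ 2 * f (r⁻¹ • x)) x = r • classicalGrad f (r⁻¹ • x) := by
  have h : fderiv ℝ (fun x => r ^ 2 * f (r⁻¹ • x)) x
      = r ^ 2 • r⁻¹ • fderiv ℝ f (r⁻¹ • x) := by
    have hd : DifferentiableAt ℝ (fun x => f (r⁻¹ • x)) x :=
      (hf.differentiable (by simp) _).comp x (by fun_prop)
    rw [fderiv_const_mul hd, fderiv_comp_smul]
  ext i
  simp only [classicalGrad, h, _root_.smul_apply, smul_eq_mul, PiLp.smul_apply]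
  field_simp

open scoped Pointwise in
theorem setIntegral_classicalGrad_rescale {f : Pt 2 → ℝ} (hf : ContDiff ℝ (⊤ : ℕ∞) f) {r : ℝ}
    (hr : 0 < r) :
    ∫ x in ball 0 r, ‖classicalGrad (fun x => r ^ 2 * f (r⁻¹ • x)) x‖ ^ 2
      = r ^ 4 * ∫ x in ball 0 1, ‖classicalGrad f x‖ ^ 2 := by
  have h := Measure.setIntegral_comp_smul_of_pos (volume : Measure (Pt 2))
    (fun x => ‖classicalGrad f x‖ ^ 2) (ball 0 r) (inv_pos.2 hr)
  have hb : r⁻¹ • ball (0 : Pt 2) r = ball 0 1 := by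
    rw [_root_.smul_ball (inv_ne_zero hr.ne')]
    simp [abs_of_pos hr, hr.ne']
  simp only [classicalGrad_rescale hf hr, norm_smul, mul_pow, Real.norm_eq_abs, sq_abs]
  rw [integral_const_mul, h, hb]
  simp only [finrank_euclideanSpace, Fintype.card_fin, smul_eq_mul]
  field_simp

/-- Comparing with the competitor which vanishes near the origin. -/
theorem not_isMinimalPair {σ : ℝ} (hfin : fracPer 2 σ tildeE (ball 0 1) ≠ ∞) {Φ : ℝ → ℝ} {r : ℝ}
    (hr : 0 < r) (b : ContDiffBump (0 : Pt 2)) (hbin : b.rIn = 1 / 2) (hbout : b.rOut = 1)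
    (hΦ : r ^ 4 * (∫ x in ball 0 1, ‖classicalGrad (cutU b) x‖ ^ 2)
        + Φ (r ^ (2 - σ) * (fracPer 2 σ joinedE (ball 0 1)).toReal)
      < Φ (r ^ (2 - σ) * (fracPer 2 σ tildeE (ball 0 1)).toReal)) :
    ¬ IsMinimalPair 2 σ Φ (ball (0 : Pt 2) r) tildeU tildeE := by
  rintro ⟨G, -, hmin⟩
  let v : Pt 2 → ℝ := fun x => r ^ 2 * cutU b (r⁻¹ • x)
  have hv : ContDiff ℝ (⊤ : ℕ∞) v :=
    contDiff_const.mul ((contDiff_cutU b).comp (contDiff_const_smul _))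
  have hvx : ∀ x, v x = (1 - b (r⁻¹ • x)) * tildeU x := by
    intro x
    simp only [v, cutU, tildeU_smul]
    field_simp
  let F : Set (Pt 2) := (r⁻¹ • ·) ⁻¹' joinedE
  have hmem : ∀ x : Pt 2, r⁻¹ • x ∈ tildeE ↔ x ∈ tildeE := fun x => by
    rw [← mem_preimage, preimage_smul_tildeE (inv_pos.2 hr)]
  have hout : ∀ x ∉ ball (0 : Pt 2) r, r⁻¹ • x ∉ ball (0 : Pt 2) 1 := by
    intro x hx
    rw [mem_ball_zero_iff, not_lt] at hx ⊢
    rw [norm_smul, norm_inv, Real.norm_eq_abs, abs_of_pos hr]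
    rwa [le_inv_mul_iff₀ hr, mul_one]
  have hb0 : ∀ x ∉ ball (0 : Pt 2) r, b (r⁻¹ • x) = 0 := fun x hx =>
    b.zero_of_le_dist <| by
      have := hout x hx
      rw [mem_ball, not_lt] at this
      rwa [hbout]
  have hvu : ∀ x ∉ ball (0 : Pt 2) r, v x = tildeU x := fun x hx => by simp [hvx, hb0 x hx]
  have hper : fracPer 2 σ F (ball 0 r)
      = ENNReal.ofReal (r ^ (2 - σ)) * fracPer 2 σ joinedE (ball 0 1) := by
    have : (fun x : Pt 2 => r • x) ⁻¹' F = joinedE := by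
      ext x
      simp [F, hr.ne']
    rw [fracPer_scale hr, this]
    simp
  have hadm : AdmissiblePair 2 σ (ball 0 r) v (classicalGrad v) F := by
    refine admissiblePair_of_contDiff hv (measurableSet_joinedE.preimage
      (measurable_const_smul _)) ?_ (fun x hx => ?_) fun x hx => ?_
    · rw [hper]
      exact ENNReal.mul_ne_top ENNReal.ofReal_ne_top (fracPer_joinedE_lt hfin).ne_top
    · rw [hvx]
      rcases hx with hx | hx
      · exact mul_nonneg (sub_nonneg.2 b.le_one) ((hmem x).1 hx).le
      · rw [b.one_of_mem_closedBall (hbin ▸ ball_subset_closedBall (squares_subset_ball hx))]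
        simp
    · rw [hvx]
      have : x ∉ tildeE := fun h => hx (Or.inl ((hmem x).2 h))
      exact mul_nonpos_of_nonneg_of_nonpos (sub_nonneg.2 b.le_one) (not_lt.1 this)
  have hw : ZeroExtGradL2 2 (ball 0 r) fun x => v x - tildeU x := by
    have hd : ContDiff ℝ (⊤ : ℕ∞) fun x => v x - tildeU x := hv.sub contDiff_tildeU
    have hind : (ball (0 : Pt 2) r).indicator (fun x => v x - tildeU x)
        = fun x => v x - tildeU x := by
      refine indicator_eq_self.2 fun x hx => ?_
      by_contra hxb
      exact hx (by simp [hvu x hxb])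
    have hs : HasCompactSupport fun x => v x - tildeU x :=
      HasCompactSupport.intro (isCompact_closedBall (0 : Pt 2) r) fun x hx => by
        simp [hvu x fun h => hx (ball_subset_closedBall h)]
    refine ⟨classicalGrad fun x => v x - tildeU x, ?_, ?_⟩
    · rw [hind]
      exact hasWeakGradOn_classicalGrad hd _
    · refine ((continuous_classicalGrad hd).norm.pow 2).integrable_of_hasCompactSupport ?_
      refine (hs.fderiv (𝕜 := ℝ)).mono fun x hx h => hx ?_
      have h0 : classicalGrad (fun x => v x - tildeU x) x = 0 := by
        ext i
        simp [classicalGrad, h]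
      simp [h0]
  have hF : volume ((F \ ball 0 r) ∆ (tildeE \ ball 0 r)) = 0 := by
    have : F \ ball 0 r = tildeE \ ball 0 r := by
      ext x
      refine and_congr_left fun hx => ?_
      have h := Set.ext_iff.1 joinedE_sdiff_ball (r⁻¹ • x)
      have h' : r⁻¹ • x ∈ joinedE ↔ r⁻¹ • x ∈ tildeE := by simpa [hout x hx] using h
      exact h'.trans (hmem x)
    simp [this]
  have h := hmin v (classicalGrad v) F hadm (Eventually.of_forall fun x hx => hvu x hx) hw hF
  rw [energyF, energyF, hper, fracPer_tildeE_ball hr, ENNReal.toReal_mul, ENNReal.toReal_mul,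
    ENNReal.toReal_ofReal (by positivity), setIntegral_classicalGrad_rescale (contDiff_cutU b) hr]
    at h
  have : 0 ≤ ∫ x in ball 0 r, ‖G x‖ ^ 2 := integral_nonneg fun x => by positivity
  linarith

theorem isMinimalPair_ball {σ R : ℝ} (hR : 0 < R) {Φ : ℝ → ℝ}
    (hfin : fracPer 2 σ tildeE (ball 0 1) ≠ ∞)
    (hΦ : ∀ F : Set (Pt 2), MeasurableSet F → fracPer 2 σ F (ball 0 R) ≠ ∞ →
      volume ((F \ ball 0 R) ∆ (tildeE \ ball 0 R)) = 0 →
      Φ (fracPer 2 σ tildeE (ball 0 R)).toReal ≤ Φ (fracPer 2 σ F (ball 0 R)).toReal) :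
    IsMinimalPair 2 σ Φ (ball (0 : Pt 2) R) tildeU tildeE := by
  refine ⟨classicalGrad tildeU, admissiblePair_of_contDiff contDiff_tildeU measurableSet_tildeE ?_
    (fun x hx => le_of_lt hx) (fun x hx => not_lt.1 hx), fun v Gv F hadm _ hw hF =>
      add_le_add (dirichlet_tildeU_le hR hadm.weakGrad hw hadm.locInt)
        (hΦ F hadm.measE hadm.perFin hF)⟩
  rw [fracPer_tildeE_ball hR]
  exact ENNReal.mul_ne_top ENNReal.ofReal_ne_top hfin

theorem exists_radius {α γ P Q D : ℝ} (hα : 0 < α) (hγ : 0 < γ) (hαγ : α * γ < 4)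
    (hQ : 0 ≤ Q) (hQP : Q < P) :
    ∃ r₀ : ℝ, 0 < r₀ ∧ ∀ r ∈ Ioc 0 r₀, r ^ α * P ≤ 1 ∧
      r ^ 4 * D + (r ^ α * Q) ^ γ < (r ^ α * P) ^ γ := by
  have hδ : Q ^ γ < P ^ γ := Real.rpow_lt_rpow hQ hQP hγ
  have h1 : ∀ᶠ r : ℝ in 𝓝 0, r ^ α * P < 1 := by
    have : Tendsto (fun r : ℝ => r ^ α * P) (𝓝 0) (𝓝 ((0 : ℝ) ^ α * P)) :=
      ((Real.continuousAt_rpow_const 0 α (Or.inr hα.le)).tendsto).mul_const P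
    rw [Real.zero_rpow hα.ne', zero_mul] at this
    exact this.eventually_lt_const one_pos
  have h2 : ∀ᶠ r : ℝ in 𝓝 0, r ^ (4 - α * γ) * D < P ^ γ - Q ^ γ := by
    have hp : 0 < 4 - α * γ := by linarith
    have : Tendsto (fun r : ℝ => r ^ (4 - α * γ) * D) (𝓝 0) (𝓝 ((0 : ℝ) ^ (4 - α * γ) * D)) :=
      ((Real.continuousAt_rpow_const 0 _ (Or.inr hp.le)).tendsto).mul_const D
    rw [Real.zero_rpow hp.ne', zero_mul] at this
    exact this.eventually_lt_const (sub_pos.2 hδ)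
  obtain ⟨ε, hε, h⟩ := Metric.eventually_nhds_iff.1 (h1.and h2)
  refine ⟨ε / 2, half_pos hε, fun r hr => ?_⟩
  obtain ⟨h1, h2⟩ := h (y := r) (by
    rw [Real.dist_eq, sub_zero, abs_of_pos hr.1]
    linarith [hr.2])
  refine ⟨h1.le, ?_⟩
  have hr0 : 0 < r := hr.1
  have hrα : 0 ≤ r ^ α := by positivity
  have hr4 : r ^ 4 = r ^ (α * γ) * r ^ (4 - α * γ) := by
    rw [← Real.rpow_add hr0, ← Real.rpow_natCast]
    congr 1
    norm_num
  rw [Real.mul_rpow hrα hQ, Real.mul_rpow hrα (hQ.trans hQP.le), ← Real.rpow_mul hr0.le, hr4]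
  nlinarith [Real.rpow_pos_of_pos hr0 (α * γ)]

/-- the explicit counterexample (Theorem 1.1 with σ ∈ (0,1)). -/
theorem statement0 (σ : ℝ) (hσ : σ ∈ Set.Ioo (0 : ℝ) 1) :
    ∃ K_o : ℝ, 2 < K_o ∧
      ∀ (Φ : ℝ → ℝ) (γ : ℝ),
        MonotoneOn Φ (Set.Ici 0) →
        LowerSemicontinuousOn Φ (Set.Ici 0) →
        (∀ t : ℝ, 0 ≤ t → 0 ≤ Φ t) →
        γ ∈ Set.Ioo (0 : ℝ) (4 / (2 - σ)) →
        (∀ t ∈ Set.Icc (0 : ℝ) 1, Φ t = t ^ γ) →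
        (∀ t ∈ Set.Icc (2 : ℝ) K_o, Φ t = 1) →
        ∃ R_o r_o : ℝ, 0 < r_o ∧ r_o < R_o ∧
          IsMinimalPair 2 σ Φ (ball (0 : Pt 2) R_o) tildeU tildeE ∧
          ∀ r ∈ Set.Ioc (0 : ℝ) r_o,
            ¬ IsMinimalPair 2 σ Φ (ball (0 : Pt 2) r) tildeU tildeE := by
  have hσ2 : 0 < 2 - σ := by linarith [hσ.2]
  have hfin := fracPer_tildeE_ne_top hσ
  obtain ⟨c, hc, hcF⟩ := exists_pos_le_fracPer hσ.1
  have hlt := fracPer_joinedE_lt hfin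
  set P := (fracPer 2 σ tildeE (ball 0 1)).toReal with hP
  have hcP : c ≤ P :=
    (ENNReal.ofReal_le_iff_le_toReal hfin).1 (hcF _ measurableSet_tildeE (by simp))
  refine ⟨max 3 (2 * P / c), lt_max_of_lt_left (by norm_num),
    fun Φ γ hmono _ _ hγ hΦγ hΦ1 => ?_⟩
  let R : ℝ := (2 / c) ^ (2 - σ)⁻¹
  have hR : 0 < R := by positivity
  have hRσ : R ^ (2 - σ) = 2 / c := Real.rpow_inv_rpow (by positivity) hσ2.ne'
  let b : ContDiffBump (0 : Pt 2) := ⟨1 / 2, 1, by norm_num, by norm_num⟩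
  obtain ⟨r₀, hr₀, hr⟩ := exists_radius (D := ∫ x in ball 0 1, ‖classicalGrad (cutU b) x‖ ^ 2)
    hσ2 hγ.1 (by have := (lt_div_iff₀ hσ2).1 hγ.2; linarith) ENNReal.toReal_nonneg
    (ENNReal.toReal_strict_mono hfin hlt)
  refine ⟨R, min r₀ (R / 2), by positivity, min_lt_of_right_lt (half_lt_self hR),
    isMinimalPair_ball hR hfin fun F hF hFfin hFE => ?_, fun r hrr => ?_⟩
  · have hPR : (fracPer 2 σ tildeE (ball 0 R)).toReal = 2 * P / c := by
      rw [fracPer_tildeE_ball hR, ENNReal.toReal_mul, ENNReal.toReal_ofReal (by positivity), hRσ]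
      ring
    have h2F : 2 ≤ (fracPer 2 σ F (ball 0 R)).toReal := by
      have h := (ENNReal.ofReal_le_iff_le_toReal hFfin).1 (le_fracPer_ball hR hcF hF hFE)
      rwa [hRσ, div_mul_cancel₀ _ hc.ne'] at h
    have hK : (2 : ℝ) ≤ max 3 (2 * P / c) := le_max_of_le_left (by norm_num)
    rw [hPR, hΦ1 _ ⟨(le_div_iff₀ hc).2 (by linarith), le_max_right _ _⟩,
      ← hΦ1 2 ⟨le_rfl, hK⟩]
    exact hmono (by simp) (zero_le_two.trans h2F) h2F
  · obtain ⟨h1, h2⟩ := hr r ⟨hrr.1, hrr.2.trans (min_le_left _ _)⟩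
    have hr0 : 0 < r := hrr.1
    have hQP : r ^ (2 - σ) * (fracPer 2 σ joinedE (ball 0 1)).toReal ≤ r ^ (2 - σ) * P :=
      mul_le_mul_of_nonneg_left (ENNReal.toReal_mono hfin hlt.le) (by positivity)
    refine not_isMinimalPair hfin hr0 b rfl rfl ?_
    rw [hΦγ _ ⟨by positivity, hQP.trans h1⟩, hΦγ _ ⟨by positivity, h1⟩]
    exact h2
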